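/- Fix A ∈ ℝ^{m×n} and integers k, ϱ with ϱ < k − 1 and k ≤ n. Let Ω ∈ ℝ^{n×k} be a real standard normal random matrix, and for each realization let P_Ω ∈ ℝ^{m×m} denote the orthogonal projection onto the column space of AΩ. Then E ‖A − P_Ω A‖_F² ≤ (1 + ϱ/(k − ϱ − 1)) · τ_{ϱ+1}(A)². (Fact A.2, randomized range finder error bound, real case.) -/

import Mathlib

open Matrix MeasureTheory ProbabilityTheory

/-- Squared Frobenius norm of a real matrix. -/
noncomputable def frobSq {m n : ℕ} (M : Matrix (Fin m) (Fin n) ℝ) : ℝ :=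
  ∑ i, ∑ j, ‖M i j‖ ^ 2

/-- Squared `j`-th tail energy: `τ_j(A)² = inf {‖A - B‖_F² : rank B < j}`. -/
noncomputable def tailEnergySq {m n : ℕ} (A : Matrix (Fin m) (Fin n) ℝ) (j : ℕ) : ℝ :=
  sInf {x : ℝ | ∃ B : Matrix (Fin m) (Fin n) ℝ, B.rank < j ∧ x = frobSq (A - B)}

instance matrixMeasurableSpace {t s : ℕ} : MeasurableSpace (Matrix (Fin t) (Fin s) ℝ) :=
  MeasurableSpace.pi

/-- The law of a `t × s` real standard normal matrix: the entries are independent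
standard Gaussians. -/
noncomputable def gaussMatrix (t s : ℕ) : Measure (Matrix (Fin t) (Fin s) ℝ) :=
  Measure.pi fun _ : Fin t => Measure.pi fun _ : Fin s => gaussianReal 0 1

open scoped ENNReal Kronecker

section StandardGaussian

variable {ι κ α : Type*} [Fintype ι] [Fintype κ] [Fintype α]

/-- The standard Gaussian measure on `ι → ℝ`. -/
noncomputable abbrev stdPi (ι : Type*) [Fintype ι] : Measure (ι → ℝ) :=
  Measure.pi fun _ : ι => gaussianReal 0 1

/-- A linear map with orthonormal rows maps the standard Gaussian measure to itself. -/
lemma map_mulVec_stdPi [DecidableEq ι] (O : Matrix ι κ ℝ) (hO : O * Oᵀ = 1) :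
    (stdPi κ).map (fun x => O *ᵥ x) = stdPi ι := by
  have hm : Measurable fun x : κ → ℝ => O *ᵥ x := by
    refine measurable_pi_lambda _ fun i => ?_
    simp only [mulVec, dotProduct]
    fun_prop
  have : IsProbabilityMeasure ((stdPi κ).map (fun x => O *ᵥ x)) :=
    Measure.isProbabilityMeasure_map hm.aemeasurable
  refine charFun_eq_pi_iff.1 fun t => ?_
  have key : charFun (((stdPi κ).map (fun x => O *ᵥ x)).map (WithLp.toLp 2)) t
      = charFun ((stdPi κ).map (WithLp.toLp 2)) (WithLp.toLp 2 (t.ofLp ᵥ* O)) := by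
    rw [Measure.map_map (by fun_prop) hm, charFun_apply, charFun_apply,
      integral_map (by fun_prop) (by fun_prop), integral_map (by fun_prop) (by fun_prop)]
    congr with x
    congr 3
    simp only [Function.comp, EuclideanSpace.inner_eq_star_dotProduct]
    simp [dotProduct_mulVec]
  rw [key, charFun_pi]
  simp only [charFun_gaussianReal, ← Complex.exp_sum]
  congr 1
  have h2 : ∑ i, (t.ofLp ᵥ* O) i ^ 2 = ∑ i, t.ofLp i ^ 2 := by
    have : (t.ofLp ᵥ* O) ⬝ᵥ (t.ofLp ᵥ* O) = t.ofLp ⬝ᵥ t.ofLp := by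
      rw [← dotProduct_mulVec, ← vecMul_transpose, vecMul_vecMul, hO, vecMul_one]
    simpa [dotProduct, sq] using this
  have h3 : (∑ i, ((t.ofLp ᵥ* O) i : ℂ) ^ 2) = ∑ i, (t.ofLp i : ℂ) ^ 2 := by
    exact_mod_cast h2
  simp [← Finset.sum_div, Finset.sum_neg_distrib, h3]

lemma map_curry_stdPi :
    (stdPi (κ × α)).map Function.curry = Measure.pi fun _ : κ => stdPi α := by
  have hm : Measurable (Function.curry : (κ × α → ℝ) → κ → α → ℝ) :=
    (MeasurableEquiv.curry κ α ℝ).measurable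
  have hu : Measurable (Function.uncurry : (κ → α → ℝ) → κ × α → ℝ) :=
    (MeasurableEquiv.curry κ α ℝ).symm.measurable
  have h : (Measure.pi fun _ : κ => stdPi α).map Function.uncurry = stdPi (κ × α) := by
    refine (Measure.pi_eq fun s hs => ?_).symm
    rw [Measure.map_apply hu (MeasurableSet.univ_pi hs)]
    have : (Function.uncurry ⁻¹' Set.univ.pi s : Set (κ → α → ℝ))
        = Set.univ.pi fun k => Set.univ.pi fun a => s (k, a) := by
      ext x; simp [Function.uncurry]
    rw [this, Measure.pi_pi]
    simp_rw [Measure.pi_pi, Fintype.prod_prod_type]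
  rw [← h, Measure.map_map hm hu]
  simp [Function.comp_def]

lemma map_mul_pi_stdPi [DecidableEq ι] (O : Matrix ι κ ℝ) (hO : O * Oᵀ = 1) :
    (Measure.pi fun _ : κ => stdPi α).map (fun x i a => ∑ j, O i j * x j a)
      = Measure.pi fun _ : ι => stdPi α := by
  classical
  have hO' : (O ⊗ₖ (1 : Matrix α α ℝ)) * (O ⊗ₖ (1 : Matrix α α ℝ))ᵀ = 1 := by
    rw [← kroneckerMap_transpose, ← mul_kronecker_mul, hO]
    simp
  rw [← map_curry_stdPi, ← map_curry_stdPi, ← map_mulVec_stdPi _ hO', Measure.map_map,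
    Measure.map_map]
  · congr 1
    ext x i a
    simp [Function.curry, mulVec, dotProduct, Fintype.sum_prod_type, kroneckerMap_apply,
      Matrix.one_apply]
  · exact (MeasurableEquiv.curry ι α ℝ).measurable
  · refine measurable_pi_lambda _ fun i => ?_
    simp only [mulVec, dotProduct]
    fun_prop
  · fun_prop
  · exact (MeasurableEquiv.curry κ α ℝ).measurable

lemma lintegral_sq_dotProduct_stdPi (v : ι → ℝ) :
    ∫⁻ x, ENNReal.ofReal ((v ⬝ᵥ x) ^ 2) ∂(stdPi ι) = ENNReal.ofReal (v ⬝ᵥ v) := by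
  have hmem : ∀ i, MemLp (fun y : ℝ => v i * y) 2 (gaussianReal 0 1) := fun i =>
    (memLp_id_gaussianReal 2).const_mul _
  have hcoord : ∀ i, MemLp (fun x : ι → ℝ => v i * x i) 2 (stdPi ι) := fun i =>
    (hmem i).comp_measurePreserving (measurePreserving_eval _ i)
  have hX : MemLp (fun x : ι → ℝ => v ⬝ᵥ x) 2 (stdPi ι) := by
    simpa only [dotProduct] using memLp_finsetSum Finset.univ fun i _ => hcoord i
  have hmean : ∫ x, v ⬝ᵥ x ∂(stdPi ι) = 0 := by
    simp only [dotProduct]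
    rw [integral_finsetSum _ fun i _ => (hcoord i).integrable (by norm_num)]
    refine Finset.sum_eq_zero fun i _ => ?_
    rw [integral_comp_eval (μ := fun _ : ι => gaussianReal 0 1) (f := fun y : ℝ => v i * y)
      (by fun_prop), integral_const_mul, integral_id_gaussianReal, mul_zero]
  have hvar : Var[fun x => v ⬝ᵥ x; stdPi ι] = v ⬝ᵥ v := by
    have h1 : ∀ i, Var[fun y : ℝ => v i * y; gaussianReal 0 1] = v i * v i := fun i => by
      rw [variance_const_mul, variance_fun_id_gaussianReal]
      simp [sq]
    have h2 := variance_sum_pi (μ := fun _ : ι => gaussianReal 0 1) hmem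
    have h3 : (∑ i, fun x : ι → ℝ => v i * x i) = fun x => v ⬝ᵥ x := by
      ext x
      simp [dotProduct]
    rw [h3, Finset.sum_congr rfl fun i _ => h1 i] at h2
    exact h2
  rw [← ofReal_integral_eq_lintegral_ofReal hX.integrable_sq (ae_of_all _ fun _ => sq_nonneg _),
    ← hvar, variance_of_integral_eq_zero hX.aemeasurable hmean]

lemma lintegral_sq_sum_pi_stdPi (a : κ → ℝ) (z : α → ℝ) :
    ∫⁻ η, ENNReal.ofReal ((∑ l, a l * (η l ⬝ᵥ z)) ^ 2) ∂(Measure.pi fun _ : κ => stdPi α)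
      = ENNReal.ofReal ((a ⬝ᵥ a) * (z ⬝ᵥ z)) := by
  have hc : Measurable (Function.curry : (κ × α → ℝ) → κ → α → ℝ) :=
    (MeasurableEquiv.curry κ α ℝ).measurable
  rw [← map_curry_stdPi, lintegral_map (by simp only [dotProduct]; fun_prop) hc]
  have h := lintegral_sq_dotProduct_stdPi fun p : κ × α => a p.1 * z p.2
  convert h using 4 with x
  · congr 1
    simp only [dotProduct, Fintype.sum_prod_type, Function.curry, Finset.mul_sum]
    refine Finset.sum_congr rfl fun i _ => Finset.sum_congr rfl fun j _ => by ring
  · simp only [dotProduct, Fintype.sum_prod_type, Finset.sum_mul_sum]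
    refine Finset.sum_congr rfl fun i _ => Finset.sum_congr rfl fun j _ => by ring

lemma integral_exp_neg_mul_sq_gaussianReal {t : ℝ} (ht : 0 < t) :
    ∫ x, Real.exp (-t * x ^ 2) ∂(gaussianReal 0 1) = (1 + 2 * t) ^ (-(1 / 2) : ℝ) := by
  rw [integral_gaussianReal_eq_integral_smul (by norm_num)]
  have : ∀ x : ℝ, gaussianPDFReal 0 1 x • Real.exp (-t * x ^ 2)
      = (√(2 * Real.pi))⁻¹ * Real.exp (-(t + 1 / 2) * x ^ 2) := by
    intro x
    simp only [gaussianPDFReal, smul_eq_mul, mul_assoc, ← Real.exp_add]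
    simp only [NNReal.coe_one, mul_one, sub_zero]
    congr 2
    ring
  simp_rw [this]
  rw [integral_const_mul, integral_gaussian, Real.rpow_neg (by positivity), ← Real.sqrt_eq_rpow,
    ← Real.sqrt_inv, ← Real.sqrt_inv, ← Real.sqrt_mul (by positivity)]
  congr 1
  field_simp
  ring

lemma lintegral_one_add_two_mul_rpow {d : ℝ} (hd : 2 < d) :
    ∫⁻ t in Set.Ioi (0 : ℝ), ENNReal.ofReal ((1 + 2 * t) ^ (-(d / 2)))
      = ENNReal.ofReal (1 / (d - 2)) := by
  have hderiv : ∀ x ∈ Set.Ici (0 : ℝ),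
      HasDerivAt (fun t : ℝ => -(1 / (d - 2)) * (1 + 2 * t) ^ (1 - d / 2))
        ((1 + 2 * x) ^ (-(d / 2))) x := by
    intro x hx
    have hx0 : (0 : ℝ) ≤ x := hx
    have h1 : HasDerivAt (fun t : ℝ => 1 + 2 * t) 2 x := by
      simpa using ((hasDerivAt_id x).const_mul 2).const_add 1
    have h2 := (h1.rpow_const (p := 1 - d / 2) (Or.inl (by positivity))).const_mul
      (-(1 / (d - 2)))
    have h3 : d - 2 ≠ 0 := by linarith
    rw [show 1 - d / 2 - 1 = -(d / 2) by ring] at h2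
    have h4 : -(1 / (d - 2)) * (2 * (1 - d / 2) * (1 + 2 * x) ^ (-(d / 2)))
        = (1 + 2 * x) ^ (-(d / 2)) := by
      rw [show 2 * (1 - d / 2) = -(d - 2) by ring]
      field_simp
    rwa [h4] at h2
  have hnn : ∀ x ∈ Set.Ioi (0 : ℝ), 0 ≤ (1 + 2 * x) ^ (-(d / 2)) := fun x hx =>
    Real.rpow_nonneg (by have : (0 : ℝ) < x := hx; positivity) _
  have hlim : Filter.Tendsto (fun t : ℝ => -(1 / (d - 2)) * (1 + 2 * t) ^ (1 - d / 2))
      Filter.atTop (nhds 0) := by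
    have h1 : Filter.Tendsto (fun t : ℝ => 1 + 2 * t) Filter.atTop Filter.atTop :=
      Filter.tendsto_atTop_add_const_left _ _ (Filter.tendsto_id.const_mul_atTop (by norm_num))
    have h2 := (tendsto_rpow_neg_atTop (y := d / 2 - 1) (by linarith)).comp h1
    have h3 := h2.const_mul (-(1 / (d - 2)))
    simpa [Function.comp_def] using h3
  rw [← ofReal_integral_eq_lintegral_ofReal
    (integrableOn_Ioi_deriv_of_nonneg' hderiv hnn hlim)
    ((ae_restrict_iff' measurableSet_Ioi).2 (ae_of_all _ hnn)),
    integral_Ioi_of_hasDerivAt_of_nonneg' hderiv hnn hlim]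
  simp

/-- The expectation of the inverse of a chi-squared variable with `d ≥ 3` degrees of freedom is
at most `1 / (d - 2)`. -/
lemma lintegral_inv_sum_sq_stdPi_le (h : 2 < Fintype.card ι) :
    ∫⁻ x, (ENNReal.ofReal (∑ i, x i ^ 2))⁻¹ ∂(stdPi ι)
      ≤ ENNReal.ofReal (1 / ((Fintype.card ι : ℝ) - 2)) := by
  have hpt : ∀ s : ℝ, 0 ≤ s →
      (ENNReal.ofReal s)⁻¹ = ∫⁻ t in Set.Ioi (0 : ℝ), ENNReal.ofReal (Real.exp (-t * s)) := by
    intro s hs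
    rcases hs.eq_or_lt with rfl | hs
    · simp
    · have hint := integrableOn_exp_mul_Ioi (a := -s) (by linarith) 0
      have := ofReal_integral_eq_lintegral_ofReal hint (ae_of_all _ fun x => (Real.exp_pos _).le)
      rw [integral_exp_mul_Ioi (by linarith)] at this
      simp only [neg_mul, mul_comm s] at this
      simp only [neg_mul]
      rw [← this, ← ENNReal.ofReal_inv_of_pos hs]
      simp
  have hinner : ∀ t ∈ Set.Ioi (0 : ℝ),
      ∫⁻ x, ENNReal.ofReal (Real.exp (-t * ∑ i, x i ^ 2)) ∂(stdPi ι)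
        = ENNReal.ofReal ((1 + 2 * t) ^ (-((Fintype.card ι : ℝ) / 2))) := by
    intro t ht
    have ht : 0 < t := ht
    have hint : Integrable (fun x => Real.exp (-t * ∑ i, x i ^ 2)) (stdPi ι) := by
      refine Integrable.of_bound (Measurable.aestronglyMeasurable (by fun_prop)) 1 (ae_of_all _ fun x => ?_)
      rw [Real.norm_eq_abs, Real.abs_exp]
      exact Real.exp_le_one_iff.2 (by
        have : 0 ≤ ∑ i, x i ^ 2 := by positivity
        nlinarith)
    rw [← ofReal_integral_eq_lintegral_ofReal hint (ae_of_all _ fun x => (Real.exp_pos _).le)]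
    simp_rw [Finset.mul_sum, Real.exp_sum]
    rw [integral_fintype_prod_eq_pow (f := fun y : ℝ => Real.exp (-t * y ^ 2)),
      integral_exp_neg_mul_sq_gaussianReal ht, ← Real.rpow_mul_natCast (by positivity)]
    congr 2
    ring
  calc ∫⁻ x, (ENNReal.ofReal (∑ i, x i ^ 2))⁻¹ ∂(stdPi ι)
    _ = ∫⁻ x, (∫⁻ t in Set.Ioi (0 : ℝ), ENNReal.ofReal (Real.exp (-t * ∑ i, x i ^ 2)))
        ∂(stdPi ι) := lintegral_congr fun x => hpt _ (by positivity)
    _ = ∫⁻ t in Set.Ioi (0 : ℝ), (∫⁻ x, ENNReal.ofReal (Real.exp (-t * ∑ i, x i ^ 2))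
        ∂(stdPi ι)) := lintegral_lintegral_swap (Measurable.aemeasurable (by
          simp only [Function.uncurry_def]; fun_prop))
    _ = ∫⁻ t in Set.Ioi (0 : ℝ),
        ENNReal.ofReal ((1 + 2 * t) ^ (-((Fintype.card ι : ℝ) / 2))) :=
      setLIntegral_congr_fun measurableSet_Ioi hinner
    _ ≤ _ := (lintegral_one_add_two_mul_rpow (by exact_mod_cast h)).le

end StandardGaussian

section DistanceToSpan

/-- The squared Euclidean distance from `x` to the row space of `W`. -/
noncomputable def rowSpaceDistSq {ι α : Type*} [Fintype ι] [Fintype α] (W : Matrix ι α ℝ)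
    (x : α → ℝ) : ℝ≥0∞ :=
  ⨅ c : ι → ℝ, ENNReal.ofReal ((x - c ᵥ* W) ⬝ᵥ (x - c ᵥ* W))

lemma measurable_rowSpaceDistSq {q k : ℕ} :
    Measurable fun p : (Fin k → ℝ) × (Fin q → Fin k → ℝ) => rowSpaceDistSq p.2 p.1 := by
  refine UpperSemicontinuous.measurable (upperSemicontinuous_iInf fun c => ?_)
  refine Continuous.upperSemicontinuous (ENNReal.continuous_ofReal.comp ?_)
  simp only [dotProduct, vecMul, Pi.sub_apply]
  fun_prop

lemma exists_orthogonal_split {m n : ℕ} (W : Matrix (Fin m) (Fin n) ℝ) :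
    ∃ (s : ℕ) (V₁ : Matrix (Fin n) (Fin W.rank) ℝ) (V₂ : Matrix (Fin n) (Fin s) ℝ),
      W.rank + s = n ∧ V₁ᵀ * V₁ = 1 ∧ V₂ᵀ * V₂ = 1 ∧ V₁ᵀ * V₂ = 0 ∧
        V₁ * V₁ᵀ + V₂ * V₂ᵀ = 1 ∧ W * V₂ = 0 := by
  let K : Submodule ℝ (EuclideanSpace ℝ (Fin n)) := LinearMap.ker (Matrix.toLpLin 2 2 W)
  have hK : ∀ x : EuclideanSpace ℝ (Fin n), x ∈ K ↔ W *ᵥ x.ofLp = 0 := fun x => by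
    simp [K, LinearMap.mem_ker, Matrix.toLpLin_apply]
  have hadd : Module.finrank ℝ K + Module.finrank ℝ Kᗮ = n := by
    simpa using K.finrank_add_finrank_orthogonal
  have hrank : W.rank = Module.finrank ℝ Kᗮ := by
    have h1 := LinearMap.finrank_range_add_finrank_ker (Matrix.toLpLin 2 2 W)
    have h2 : W.rank = Module.finrank ℝ (LinearMap.range (Matrix.toLpLin 2 2 W)) := by
      rw [Matrix.toLpLin_eq_toLin]
      exact Matrix.rank_eq_finrank_range_toLin W _ _
    simp only [finrank_euclideanSpace, Fintype.card_fin] at h1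
    change _ + Module.finrank ℝ K = n at h1
    omega
  let b₁ : OrthonormalBasis (Fin W.rank) ℝ Kᗮ :=
    (stdOrthonormalBasis ℝ Kᗮ).reindex (finCongr hrank.symm)
  let b₂ : OrthonormalBasis (Fin (Module.finrank ℝ K)) ℝ K := stdOrthonormalBasis ℝ K
  let V₁ : Matrix (Fin n) (Fin W.rank) ℝ := .of fun i j => (b₁ j : EuclideanSpace ℝ (Fin n)) i
  let V₂ : Matrix (Fin n) (Fin (Module.finrank ℝ K)) ℝ :=
    .of fun i j => (b₂ j : EuclideanSpace ℝ (Fin n)) i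
  have h11 : V₁ᵀ * V₁ = 1 := by
    ext i j
    rw [Matrix.one_apply, ← orthonormal_iff_ite.1 b₁.orthonormal i j,
      Submodule.coe_inner, PiLp.inner_apply]
    rw [Matrix.mul_apply]
    exact Finset.sum_congr rfl fun x _ => mul_comm (V₁ x i) (V₁ x j)
  have h22 : V₂ᵀ * V₂ = 1 := by
    ext i j
    rw [Matrix.one_apply, ← orthonormal_iff_ite.1 b₂.orthonormal i j,
      Submodule.coe_inner, PiLp.inner_apply]
    rw [Matrix.mul_apply]
    exact Finset.sum_congr rfl fun x _ => mul_comm (V₂ x i) (V₂ x j)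
  have h12 : V₁ᵀ * V₂ = 0 := by
    ext i j
    have : inner ℝ (b₂ j : EuclideanSpace ℝ (Fin n)) (b₁ i) = 0 :=
      (K.mem_orthogonal _).1 (b₁ i).2 _ (b₂ j).2
    rw [PiLp.inner_apply] at this
    exact this
  have h21 : V₂ᵀ * V₁ = 0 := by
    rw [← transpose_transpose V₁, ← transpose_mul, h12, transpose_zero]
  refine ⟨Module.finrank ℝ K, V₁, V₂, by omega, h11, h22, h12, ?_, ?_⟩
  · have hV : (fromCols V₁ V₂)ᵀ * fromCols V₁ V₂ = 1 := by
      rw [transpose_fromCols, fromRows_mul_fromCols, h11, h22, h12, h21, fromBlocks_one]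
    have hcard : Fintype.card (Fin W.rank ⊕ Fin (Module.finrank ℝ K)) = Fintype.card (Fin n) := by
      simp
      omega
    rw [Matrix.mul_eq_one_comm_of_card_eq _ _ _ hcard] at hV
    rwa [transpose_fromCols, fromCols_mul_fromRows] at hV
  · ext i j
    have := congrFun ((hK _).1 (b₂ j).2) i
    exact this

lemma exists_orthonormal_rows {q k d : ℕ} (W : Matrix (Fin q) (Fin k) ℝ) (h : q + d ≤ k) :
    ∃ O : Matrix (Fin d) (Fin k) ℝ, O * Oᵀ = 1 ∧ W * Oᵀ = 0 := by
  obtain ⟨s, -, V, hs, -, hV, -, -, hW⟩ := exists_orthogonal_split W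
  have hr : W.rank ≤ q := by simpa using W.rank_le_card_height
  have hds : d ≤ s := by omega
  refine ⟨Vᵀ.submatrix (Fin.castLE hds) id, ?_, ?_⟩
  · ext i j
    have := congrFun (congrFun hV (Fin.castLE hds i)) (Fin.castLE hds j)
    simpa [Matrix.mul_apply, Matrix.one_apply] using this
  · ext i j
    have := congrFun (congrFun hW i) (Fin.castLE hds j)
    simpa [Matrix.mul_apply] using this

lemma mulVec_dotProduct_self_le {ι α : Type*} [Fintype ι] [DecidableEq ι] [Fintype α]
    (O : Matrix ι α ℝ) (hO : O * Oᵀ = 1) (x : α → ℝ) : (O *ᵥ x) ⬝ᵥ (O *ᵥ x) ≤ x ⬝ᵥ x := by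
  have h1 : x ⬝ᵥ (Oᵀ *ᵥ (O *ᵥ x)) = (O *ᵥ x) ⬝ᵥ (O *ᵥ x) := by
    rw [dotProduct_mulVec, vecMul_transpose]
  have h2 : (Oᵀ *ᵥ (O *ᵥ x)) ⬝ᵥ (Oᵀ *ᵥ (O *ᵥ x)) = (O *ᵥ x) ⬝ᵥ (O *ᵥ x) := by
    rw [dotProduct_mulVec, vecMul_transpose, mulVec_mulVec, hO, one_mulVec]
  have h3 : 0 ≤ (x - Oᵀ *ᵥ (O *ᵥ x)) ⬝ᵥ (x - Oᵀ *ᵥ (O *ᵥ x)) := by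
    simpa using dotProduct_star_self_nonneg (x - Oᵀ *ᵥ (O *ᵥ x))
  rw [sub_dotProduct, dotProduct_sub, dotProduct_sub, h2, h1, dotProduct_comm (Oᵀ *ᵥ _) x, h1] at h3
  linarith

lemma lintegral_inv_rowSpaceDistSq_le {q k d : ℕ} (W : Matrix (Fin q) (Fin k) ℝ)
    (h : q + d ≤ k) (hd : 2 < d) :
    ∫⁻ x, (rowSpaceDistSq W x)⁻¹ ∂(stdPi (Fin k)) ≤ ENNReal.ofReal (1 / ((d : ℝ) - 2)) := by
  obtain ⟨O, hO, hW⟩ := exists_orthonormal_rows W h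
  have hm : Measurable fun x : Fin k → ℝ => O *ᵥ x := by
    refine measurable_pi_lambda _ fun i => ?_
    simp only [mulVec, dotProduct]
    fun_prop
  have hle : ∀ x, ENNReal.ofReal (∑ i, (O *ᵥ x) i ^ 2) ≤ rowSpaceDistSq W x := fun x => by
    refine le_iInf fun c => ENNReal.ofReal_le_ofReal ?_
    have hx : O *ᵥ (x - c ᵥ* W) = O *ᵥ x := by
      rw [mulVec_sub, ← vecMul_transpose O (c ᵥ* W), vecMul_vecMul, hW, vecMul_zero, sub_zero]
    calc ∑ i, (O *ᵥ x) i ^ 2 = (O *ᵥ (x - c ᵥ* W)) ⬝ᵥ (O *ᵥ (x - c ᵥ* W)) := by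
          rw [hx]; simp [dotProduct, sq]
      _ ≤ _ := mulVec_dotProduct_self_le O hO _
  calc ∫⁻ x, (rowSpaceDistSq W x)⁻¹ ∂(stdPi (Fin k))
    _ ≤ ∫⁻ x, (ENNReal.ofReal (∑ i, (O *ᵥ x) i ^ 2))⁻¹ ∂(stdPi (Fin k)) :=
      lintegral_mono fun x => ENNReal.inv_le_inv.2 (hle x)
    _ = ∫⁻ y, (ENNReal.ofReal (∑ i, y i ^ 2))⁻¹ ∂(stdPi (Fin d)) := by
      rw [← map_mulVec_stdPi O hO, lintegral_map (by fun_prop) hm]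
    _ ≤ _ := by
      simpa using lintegral_inv_sum_sq_stdPi_le (ι := Fin d) (by simpa using hd)

lemma exists_rowSpace_dual_vector {q k : ℕ} (W : Matrix (Fin q) (Fin k) ℝ) (x : Fin k → ℝ)
    (h : rowSpaceDistSq W x ≠ 0) :
    ∃ y : Fin k → ℝ, W *ᵥ y = 0 ∧ x ⬝ᵥ y = 1 ∧
      ENNReal.ofReal (y ⬝ᵥ y) ≤ (rowSpaceDistSq W x)⁻¹ := by
  let U : Submodule ℝ (EuclideanSpace ℝ (Fin k)) :=
    Submodule.span ℝ (Set.range fun i => WithLp.toLp 2 (W i))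
  let p : EuclideanSpace ℝ (Fin k) := U.starProjection (WithLp.toLp 2 x)
  obtain ⟨c, hc⟩ := (Submodule.mem_span_range_iff_exists_fun ℝ).1
    (U.starProjection_apply_mem (WithLp.toLp 2 x))
  have hp : p.ofLp = c ᵥ* W := by
    change (U.starProjection (WithLp.toLp 2 x)).ofLp = _
    rw [← hc]
    ext a
    simp [vecMul, dotProduct]
  let z : Fin k → ℝ := x - c ᵥ* W
  have hzU : ∀ u ∈ U, u.ofLp ⬝ᵥ z = 0 := fun u hu => by
    have := U.sub_starProjection_mem_orthogonal (WithLp.toLp 2 x)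
    have := (U.mem_orthogonal _).1 this u hu
    rw [EuclideanSpace.inner_eq_star_dotProduct] at this
    rw [dotProduct_comm]
    simpa [z, ← hp, p] using this
  have hWz : W *ᵥ z = 0 := by
    ext i
    exact hzU _ (Submodule.subset_span ⟨i, rfl⟩)
  have hxz : x ⬝ᵥ z = z ⬝ᵥ z := by
    have : z ⬝ᵥ z = x ⬝ᵥ z - (c ᵥ* W) ⬝ᵥ z := sub_dotProduct _ _ _
    rw [this, ← dotProduct_mulVec, hWz, dotProduct_zero, sub_zero]
  have hle : rowSpaceDistSq W x ≤ ENNReal.ofReal (z ⬝ᵥ z) := iInf_le _ c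
  have hpos : 0 < z ⬝ᵥ z := by
    by_contra! hz
    rw [ENNReal.ofReal_of_nonpos hz] at hle
    exact h (le_antisymm hle zero_le)
  refine ⟨(z ⬝ᵥ z)⁻¹ • z, ?_, ?_, ?_⟩
  · rw [mulVec_smul, hWz, smul_zero]
  · rw [dotProduct_smul, hxz, smul_eq_mul, inv_mul_cancel₀ hpos.ne']
  · rw [smul_dotProduct, dotProduct_smul, smul_eq_mul, smul_eq_mul, inv_mul_cancel₀ hpos.ne',
      mul_one, ENNReal.ofReal_inv_of_pos hpos]
    exact ENNReal.inv_le_inv.2 hle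

/-- Almost every Gaussian matrix with `r` rows has a right inverse whose columns have squared
norms dominated by functions of expectation at most `1 / (k - r - 1)`. -/
lemma exists_right_inverse_bound {r k : ℕ} (hrk : r + 1 < k) (j : Fin r) :
    ∃ H : (Fin r → Fin k → ℝ) → ℝ≥0∞, Measurable H ∧
      ∫⁻ ω, H ω ∂(Measure.pi fun _ : Fin r => stdPi (Fin k))
        ≤ ENNReal.ofReal (1 / ((k : ℝ) - r - 1)) ∧
      ∀ ω, H ω ≠ ∞ → ∃ y : Fin k → ℝ, (∀ i, ω i ⬝ᵥ y = if i = j then 1 else 0) ∧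
        ENNReal.ofReal (y ⬝ᵥ y) ≤ H ω := by
  obtain ⟨q, rfl⟩ : ∃ q, r = q + 1 := ⟨r - 1, by have := j.pos; omega⟩
  let e := MeasurableEquiv.piFinSuccAbove (fun _ : Fin (q + 1) => Fin k → ℝ) j
  have he : MeasurePreserving e (Measure.pi fun _ : Fin (q + 1) => stdPi (Fin k))
      ((stdPi (Fin k)).prod (Measure.pi fun _ : Fin q => stdPi (Fin k))) :=
    measurePreserving_piFinSuccAbove (fun _ : Fin (q + 1) => stdPi (Fin k)) j
  let F : (Fin k → ℝ) × (Fin q → Fin k → ℝ) → ℝ≥0∞ := fun p => (rowSpaceDistSq p.2 p.1)⁻¹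
  have hF : Measurable F := measurable_rowSpaceDistSq.inv
  refine ⟨fun ω => F (e ω), hF.comp e.measurable, ?_, fun ω hω => ?_⟩
  · rw [he.lintegral_comp hF, lintegral_prod_symm _ hF.aemeasurable]
    obtain ⟨d, hd⟩ : ∃ d, d = k - q := ⟨_, rfl⟩
    have hdk : (d : ℝ) = k - q := by rw [hd, Nat.cast_sub (by omega)]
    calc ∫⁻ w, (∫⁻ x, F (x, w) ∂(stdPi (Fin k))) ∂(Measure.pi fun _ : Fin q => stdPi (Fin k))
      _ ≤ ∫⁻ _, ENNReal.ofReal (1 / ((d : ℝ) - 2)) ∂(Measure.pi fun _ : Fin q => stdPi (Fin k)) :=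
        lintegral_mono fun w => lintegral_inv_rowSpaceDistSq_le w (by omega) (by omega)
      _ = _ := by
        rw [lintegral_const, measure_univ, mul_one, hdk]
        push_cast
        ring_nf
  · obtain ⟨y, hy1, hy2, hy3⟩ := exists_rowSpace_dual_vector (fun i => ω (j.succAbove i)) (ω j)
      (ENNReal.inv_ne_top.1 hω)
    refine ⟨y, fun i => ?_, hy3⟩
    rcases Fin.eq_self_or_eq_succAbove j i with rfl | ⟨i', rfl⟩
    · simpa using hy2
    · rw [if_neg (Fin.succAbove_ne j i')]
      exact congrFun hy1 i'

end DistanceToSpan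

section Frobenius

variable {l m n r s : ℕ}

lemma frobSq_eq_trace (N : Matrix (Fin m) (Fin n) ℝ) : frobSq N = (N * Nᵀ).trace := by
  simp [frobSq, trace, Matrix.mul_apply, sq]

lemma frobSq_nonneg (N : Matrix (Fin m) (Fin n) ℝ) : 0 ≤ frobSq N := by
  unfold frobSq
  positivity

lemma frobSq_sub_mul_le (Q : Matrix (Fin m) (Fin m) ℝ) (hsym : Qᵀ = Q) (hidem : Q * Q = Q)
    (N : Matrix (Fin m) (Fin n) ℝ) : frobSq (N - Q * N) ≤ frobSq N := by
  have h1 : (N * (Nᵀ * Q)).trace = (Q * (N * Nᵀ)).trace := by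
    rw [← Matrix.mul_assoc, trace_mul_comm]
  have h2 : (Q * (N * (Nᵀ * Q))).trace = (Q * (N * Nᵀ)).trace := by
    rw [trace_mul_comm, Matrix.mul_assoc, Matrix.mul_assoc, hidem, h1]
  have h : frobSq N = frobSq (N - Q * N) + frobSq (Q * N) := by
    simp only [frobSq_eq_trace, transpose_sub, transpose_mul, hsym, Matrix.sub_mul,
      Matrix.mul_sub, trace_sub, Matrix.mul_assoc, h1, h2]
    ring
  linarith [frobSq_nonneg (Q * N)]

lemma frobSq_mul_transpose_sub (V₁ : Matrix (Fin n) (Fin r) ℝ) (V₂ : Matrix (Fin n) (Fin s) ℝ)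
    (h11 : V₁ᵀ * V₁ = 1) (h22 : V₂ᵀ * V₂ = 1) (h12 : V₁ᵀ * V₂ = 0)
    (C : Matrix (Fin m) (Fin s) ℝ) (D : Matrix (Fin m) (Fin r) ℝ) :
    frobSq (C * V₂ᵀ - D * V₁ᵀ) = frobSq C + frobSq D := by
  have h21 : V₂ᵀ * V₁ = 0 := by
    rw [← transpose_transpose V₁, ← transpose_mul, h12, transpose_zero]
  have h : (C * V₂ᵀ - D * V₁ᵀ) * (C * V₂ᵀ - D * V₁ᵀ)ᵀ = C * (V₂ᵀ * V₂) * Cᵀ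
      - C * (V₂ᵀ * V₁) * Dᵀ - D * (V₁ᵀ * V₂) * Cᵀ + D * (V₁ᵀ * V₁) * Dᵀ := by
    simp only [transpose_sub, transpose_mul, transpose_transpose, Matrix.sub_mul,
      Matrix.mul_sub, Matrix.mul_assoc]
    abel
  rw [frobSq_eq_trace, h, h11, h22, h12, h21]
  simp [frobSq_eq_trace]

lemma frobSq_mul_le (V₁ : Matrix (Fin n) (Fin r) ℝ) (V₂ : Matrix (Fin n) (Fin s) ℝ)
    (hV : V₁ * V₁ᵀ + V₂ * V₂ᵀ = 1) (N : Matrix (Fin m) (Fin n) ℝ) :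
    frobSq (N * V₂) ≤ frobSq N := by
  have h : frobSq N = frobSq (N * V₁) + frobSq (N * V₂) := by
    rw [frobSq_eq_trace, ← Matrix.mul_one N, ← hV, frobSq_eq_trace, frobSq_eq_trace, ← trace_add]
    rw [hV, Matrix.mul_one]
    congr 1
    calc N * Nᵀ = N * (V₁ * V₁ᵀ + V₂ * V₂ᵀ) * Nᵀ := by rw [hV, Matrix.mul_one]
      _ = _ := by
        simp only [transpose_mul, Matrix.mul_add, Matrix.add_mul, Matrix.mul_assoc]
  linarith [frobSq_nonneg (N * V₁)]

lemma frobSq_sub_proj_mul_le (A : Matrix (Fin m) (Fin n) ℝ) (Q : Matrix (Fin m) (Fin m) ℝ)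
    (hsym : Qᵀ = Q) (hidem : Q * Q = Q)
    (V₁ : Matrix (Fin n) (Fin r) ℝ) (V₂ : Matrix (Fin n) (Fin s) ℝ)
    (h11 : V₁ᵀ * V₁ = 1) (h22 : V₂ᵀ * V₂ = 1) (h12 : V₁ᵀ * V₂ = 0)
    (hV : V₁ * V₁ᵀ + V₂ * V₂ᵀ = 1)
    (ω : Matrix (Fin r) (Fin l) ℝ) (η : Matrix (Fin s) (Fin l) ℝ) (X : Matrix (Fin l) (Fin r) ℝ)
    (hX : ω * X = 1)
    (hfix : Q * (A * (V₁ * ω + V₂ * η)) = A * (V₁ * ω + V₂ * η)) :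
    frobSq (A - Q * A) ≤ frobSq (A * V₂) + frobSq (A * V₂ * η * X) := by
  set Y := A * (V₁ * ω + V₂ * η) with hY
  have h1 : A - Q * A = (A - Y * X * V₁ᵀ) - Q * (A - Y * X * V₁ᵀ) := by
    rw [Matrix.mul_sub, ← Matrix.mul_assoc, ← Matrix.mul_assoc, hfix]
    abel
  have h2 : A - Y * X * V₁ᵀ = (A * V₂) * V₂ᵀ - (A * V₂ * η * X) * V₁ᵀ := by
    have hYX : Y * X * V₁ᵀ = A * (V₁ * V₁ᵀ) + (A * V₂ * η * X) * V₁ᵀ := by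
      have : Y * X = A * V₁ * (ω * X) + A * V₂ * η * X := by
        simp only [hY, Matrix.mul_add, Matrix.add_mul, Matrix.mul_assoc]
      rw [this, hX, Matrix.mul_one, Matrix.add_mul, Matrix.mul_assoc A]
    have hA : A = A * (V₁ * V₁ᵀ) + A * V₂ * V₂ᵀ := by
      rw [Matrix.mul_assoc, ← Matrix.mul_add, hV, Matrix.mul_one]
    rw [hYX]
    nth_rewrite 1 [hA]
    abel
  rw [h1]
  refine (frobSq_sub_mul_le Q hsym hidem _).trans_eq ?_
  rw [h2, frobSq_mul_transpose_sub V₁ V₂ h11 h22 h12]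

end Frobenius

section GaussianMatrix

variable {k m n r s : ℕ}

lemma lintegral_gaussMatrix_le (V₁ : Matrix (Fin n) (Fin r) ℝ) (V₂ : Matrix (Fin n) (Fin s) ℝ)
    (hV : V₁ * V₁ᵀ + V₂ * V₂ᵀ = 1) (f : Matrix (Fin n) (Fin k) ℝ → ℝ≥0∞) :
    ∫⁻ Ω, f Ω ∂(gaussMatrix n k) ≤
      ∫⁻ ω : Fin r → Fin k → ℝ, ∫⁻ η : Fin s → Fin k → ℝ, f (V₁ * of ω + V₂ * of η)
        ∂(Measure.pi fun _ => stdPi (Fin k)) ∂(Measure.pi fun _ => stdPi (Fin k)) := by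
  have hO : fromCols V₁ V₂ * (fromCols V₁ V₂)ᵀ = 1 := by
    rw [transpose_fromCols, fromCols_mul_fromRows, hV]
  have hg : gaussMatrix n k = (Measure.pi fun _ : Fin r ⊕ Fin s => stdPi (Fin k)).map
      fun x i a => ∑ j, fromCols V₁ V₂ i j * x j a :=
    (map_mul_pi_stdPi (α := Fin k) _ hO).symm
  have hp := (measurePreserving_sumPiEquivProdPi_symm
    fun _ : Fin r ⊕ Fin s => stdPi (Fin k)).map_eq
  rw [hg, ← hp]
  refine (lintegral_map_le _ _).trans ((lintegral_map_le _ _).trans ?_)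
  refine (lintegral_prod_le _).trans (le_of_eq ?_)
  refine lintegral_congr fun ω => lintegral_congr fun η => congrArg f ?_
  ext i a
  rw [Fintype.sum_sum_type]
  rfl

lemma lintegral_frobSq_mul_le (C : Matrix (Fin m) (Fin s) ℝ) (y : Fin r → Fin k → ℝ) :
    ∫⁻ η : Fin s → Fin k → ℝ, ENNReal.ofReal (frobSq (C * of η * (of y)ᵀ))
        ∂(Measure.pi fun _ => stdPi (Fin k))
      ≤ ENNReal.ofReal (frobSq C) * ∑ j, ENNReal.ofReal (y j ⬝ᵥ y j) := by
  have h (η : Fin s → Fin k → ℝ) : ENNReal.ofReal (frobSq (C * of η * (of y)ᵀ))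
      = ∑ i, ∑ j, ENNReal.ofReal ((∑ a, C i a * (η a ⬝ᵥ y j)) ^ 2) := by
    rw [frobSq, ENNReal.ofReal_sum_of_nonneg fun i _ => by positivity]
    refine Finset.sum_congr rfl fun i _ => ?_
    rw [ENNReal.ofReal_sum_of_nonneg fun i _ => by positivity]
    refine Finset.sum_congr rfl fun j _ => ?_
    rw [Matrix.mul_assoc, Real.norm_eq_abs, sq_abs]
    rfl
  have hC : ENNReal.ofReal (frobSq C) = ∑ i, ENNReal.ofReal (C i ⬝ᵥ C i) := by
    rw [frobSq, ENNReal.ofReal_sum_of_nonneg fun i _ => by positivity]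
    simp [dotProduct, sq]
  simp_rw [h]
  rw [lintegral_finsetSum _ fun i _ => by unfold dotProduct; fun_prop, hC, Finset.sum_mul]
  refine Finset.sum_le_sum fun i _ => ?_
  rw [lintegral_finsetSum _ fun i _ => by unfold dotProduct; fun_prop, Finset.mul_sum]
  refine Finset.sum_le_sum fun j _ => ?_
  rw [lintegral_sq_sum_pi_stdPi, ENNReal.ofReal_mul]
  simpa using dotProduct_star_self_nonneg (C i)

lemma lintegral_frobSq_sub_proj_le {ϱ : ℕ} (hϱ : ϱ + 1 < k) (A B : Matrix (Fin m) (Fin n) ℝ)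
    (hB : B.rank ≤ ϱ) (P : Matrix (Fin n) (Fin k) ℝ → Matrix (Fin m) (Fin m) ℝ)
    (hsym : ∀ Ω, (P Ω)ᵀ = P Ω) (hidem : ∀ Ω, P Ω * P Ω = P Ω)
    (hfix : ∀ Ω, P Ω * (A * Ω) = A * Ω) :
    ∫⁻ Ω, ENNReal.ofReal (frobSq (A - P Ω * A)) ∂(gaussMatrix n k)
      ≤ ENNReal.ofReal ((1 + (ϱ : ℝ) / ((k : ℝ) - ϱ - 1)) * frobSq (A - B)) := by
  obtain ⟨s, V₁, V₂, -, h11, h22, h12, hV, hBV⟩ := exists_orthogonal_split B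
  have hr : B.rank + 1 < k := by omega
  choose H hHm hHi hH using exists_right_inverse_bound hr
  have hfin : ∀ᵐ ω ∂(Measure.pi fun _ : Fin B.rank => stdPi (Fin k)), ∀ j, H j ω ≠ ∞ :=
    ae_all_iff.2 fun j => (ae_lt_top (hHm j) ((hHi j).trans_lt ENNReal.ofReal_lt_top).ne).mono
      fun _ h => h.ne
  have hle : frobSq (A * V₂) ≤ frobSq (A - B) := by
    simpa [Matrix.sub_mul, hBV] using frobSq_mul_le V₁ V₂ hV (A - B)
  have hkr : (0 : ℝ) < (k : ℝ) - B.rank - 1 := by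
    have : ((B.rank + 1 : ℕ) : ℝ) < k := by exact_mod_cast hr
    push_cast at this
    linarith
  have hkϱ : (0 : ℝ) < (k : ℝ) - ϱ - 1 := by
    have : ((ϱ + 1 : ℕ) : ℝ) < k := by exact_mod_cast hϱ
    push_cast at this
    linarith
  have hBϱ : (B.rank : ℝ) ≤ ϱ := by exact_mod_cast hB
  calc ∫⁻ Ω, ENNReal.ofReal (frobSq (A - P Ω * A)) ∂(gaussMatrix n k)
    _ ≤ ∫⁻ ω : Fin B.rank → Fin k → ℝ, ∫⁻ η : Fin s → Fin k → ℝ,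
        ENNReal.ofReal (frobSq (A - P (V₁ * of ω + V₂ * of η) * A))
        ∂(Measure.pi fun _ => stdPi (Fin k)) ∂(Measure.pi fun _ => stdPi (Fin k)) :=
      lintegral_gaussMatrix_le V₁ V₂ hV _
    _ ≤ ∫⁻ ω : Fin B.rank → Fin k → ℝ, ENNReal.ofReal (frobSq (A * V₂)) * (1 + ∑ j, H j ω)
        ∂(Measure.pi fun _ => stdPi (Fin k)) := by
      refine lintegral_mono_ae (hfin.mono fun ω hω => ?_)
      choose y hy hyH using fun j => hH j ω (hω j)
      have hX : of ω * (of y)ᵀ = 1 := by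
        ext i j
        rw [Matrix.one_apply]
        exact hy j i
      calc ∫⁻ η : Fin s → Fin k → ℝ, ENNReal.ofReal (frobSq (A - P (V₁ * of ω + V₂ * of η) * A))
            ∂(Measure.pi fun _ => stdPi (Fin k))
        _ ≤ ∫⁻ η : Fin s → Fin k → ℝ, (ENNReal.ofReal (frobSq (A * V₂))
            + ENNReal.ofReal (frobSq (A * V₂ * of η * (of y)ᵀ)))
            ∂(Measure.pi fun _ => stdPi (Fin k)) := by
          refine lintegral_mono fun η => ?_
          rw [← ENNReal.ofReal_add (frobSq_nonneg _) (frobSq_nonneg _)]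
          exact ENNReal.ofReal_le_ofReal (frobSq_sub_proj_mul_le A _ (hsym _) (hidem _) V₁ V₂
            h11 h22 h12 hV _ _ _ hX (hfix _))
        _ ≤ ENNReal.ofReal (frobSq (A * V₂))
            + ENNReal.ofReal (frobSq (A * V₂)) * ∑ j, ENNReal.ofReal (y j ⬝ᵥ y j) := by
          rw [lintegral_add_left measurable_const, lintegral_const, measure_univ, mul_one]
          gcongr
          exact lintegral_frobSq_mul_le _ _
        _ ≤ ENNReal.ofReal (frobSq (A * V₂)) * (1 + ∑ j, H j ω) := by
          rw [mul_add, mul_one]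
          gcongr
          exact hyH _
    _ ≤ ENNReal.ofReal (frobSq (A * V₂))
        * (1 + ∑ _j : Fin B.rank, ENNReal.ofReal (1 / ((k : ℝ) - B.rank - 1))) := by
      rw [lintegral_const_mul _ (by fun_prop), lintegral_add_left measurable_const,
        lintegral_const, measure_univ, mul_one, lintegral_finsetSum _ fun j _ => hHm j]
      gcongr
      exact hHi _
    _ = ENNReal.ofReal ((1 + (B.rank : ℝ) / ((k : ℝ) - B.rank - 1)) * frobSq (A * V₂)) := by
      rw [Finset.sum_const, Finset.card_univ, Fintype.card_fin, nsmul_eq_mul,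
        ← ENNReal.ofReal_natCast, ← ENNReal.ofReal_mul (by positivity), mul_one_div,
        ← ENNReal.ofReal_one, ← ENNReal.ofReal_add zero_le_one (by positivity),
        ← ENNReal.ofReal_mul (frobSq_nonneg _), mul_comm]
    _ ≤ _ := by
      refine ENNReal.ofReal_le_ofReal ?_
      have := frobSq_nonneg (A * V₂)
      gcongr

end GaussianMatrix

/-- **Fact A.2 (randomized range finder error bound), real case.**  For `Ω ∈ ℝ^{n×k}` a
standard normal matrix and `P Ω` the orthogonal projection onto the column space of `AΩ`
(characterized by: symmetric, idempotent, fixing `AΩ`, and with range inside the column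
space of `AΩ`), for every natural `ϱ < k - 1`:
`E ‖A - P_Ω A‖_F² ≤ (1 + ϱ/(k - ϱ - 1)) τ_{ϱ+1}(A)²`. -/
theorem randomized_range_finder {m n k : ℕ} (ϱ : ℕ) (hϱ : ϱ + 1 < k) (hk : k ≤ n)
    (A : Matrix (Fin m) (Fin n) ℝ)
    (P : Matrix (Fin n) (Fin k) ℝ → Matrix (Fin m) (Fin m) ℝ)
    (hsym : ∀ Ω, (P Ω)ᵀ = P Ω)
    (hidem : ∀ Ω, P Ω * P Ω = P Ω)
    (hfix : ∀ Ω, P Ω * (A * Ω) = A * Ω)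
    (hrange : ∀ Ω, ∃ M : Matrix (Fin k) (Fin m) ℝ, P Ω = A * Ω * M) :
    ∫ Ω, frobSq (A - P Ω * A) ∂(gaussMatrix n k)
      ≤ (1 + (ϱ : ℝ) / ((k : ℝ) - ϱ - 1)) * tailEnergySq A (ϱ + 1) := by
  have hkϱ : (0 : ℝ) < (k : ℝ) - ϱ - 1 := by
    have : ((ϱ + 1 : ℕ) : ℝ) < k := by exact_mod_cast hϱ
    push_cast at this
    linarith
  have hc : (0 : ℝ) < 1 + (ϱ : ℝ) / ((k : ℝ) - ϱ - 1) := by positivity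
  rw [← div_le_iff₀' hc]
  refine le_csInf ⟨_, 0, by simp, rfl⟩ ?_
  rintro _ ⟨B, hB, rfl⟩
  rw [div_le_iff₀' hc]
  have hnonneg : 0 ≤ (1 + (ϱ : ℝ) / ((k : ℝ) - ϱ - 1)) * frobSq (A - B) :=
    mul_nonneg hc.le (frobSq_nonneg _)
  by_cases hm : AEStronglyMeasurable (fun Ω => frobSq (A - P Ω * A)) (gaussMatrix n k)
  · rw [integral_eq_lintegral_of_nonneg_ae (ae_of_all _ fun Ω => frobSq_nonneg _) hm]
    exact ENNReal.toReal_le_of_le_ofReal hnonneg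
      (lintegral_frobSq_sub_proj_le hϱ A B (by omega) P hsym hidem hfix)
  · rwa [integral_non_aestronglyMeasurable hm]
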